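/- arXiv:1702.08215 — 4 statements merged into one kernel-verified Lean document; each statement's English description precedes it below -/
import Mathlib

section
/- The set of ideals {L^I : I ∈ ℕ_0^n} of R_{A,Q}[x_0,…,x_M] is finite. -/
open Filter MvPolynomial

namespace MovingTargets

noncomputable section

variable {k Λ : Type} [Field k]

/-- The filter of cofinite subsets of `A` (as a filter on `Λ`). -/
def cofinOn (Λ : Type) (A : Set Λ) : Filter Λ := Filter.cofinite ⊓ Filter.principal A

/-- A subset `A ⊆ Λ` is coherent with respect to the moving hypersurfaces `Q` if every
polynomial in the coefficients of the `Q j`, homogeneous in the block of coefficients of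
each `Q j`, vanishes at all `α ∈ A` or at only finitely many of them. -/
def Coherent {M q : ℕ} (A : Set Λ) (Q : Fin q → Λ → MvPolynomial (Fin (M + 1)) k) : Prop :=
  ∀ P : MvPolynomial (Fin q × (Fin (M + 1) →₀ ℕ)) k,
    (∀ j : Fin q, ∃ e : ℕ, ∀ m ∈ P.support,
        (m.sum fun v c => if v.1 = j then c else 0) = e) →
    ((∀ α ∈ A, MvPolynomial.eval (fun p => MvPolynomial.coeff p.2 (Q p.1 α)) P = 0) ∨
      {α ∈ A | MvPolynomial.eval (fun p => MvPolynomial.coeff p.2 (Q p.1 α)) P = 0}.Finite)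

/-- The normalized coefficient ratio functions `α ↦ a_{j,I}(α) / a_{j,I_j}(α)`. -/
def ratioFun {M q : ℕ} (Q : Fin q → Λ → MvPolynomial (Fin (M + 1)) k)
    (Ij : Fin q → (Fin (M + 1) →₀ ℕ)) (j : Fin q) (I : Fin (M + 1) →₀ ℕ) : Λ → k :=
  fun α => MvPolynomial.coeff I (Q j α) / MvPolynomial.coeff (Ij j) (Q j α)

/-- The subring of (pointwise) functions `Λ → k` generated over `k` by the coefficient
ratio functions. -/
def kQRing {M q : ℕ} (Q : Fin q → Λ → MvPolynomial (Fin (M + 1)) k)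
    (Ij : Fin q → (Fin (M + 1) →₀ ℕ)) : Subring (Λ → k) :=
  Subring.closure
    (Set.range (fun c : k => Function.const Λ c) ∪ {f | ∃ j I, f = ratioFun Q Ij j I})

/-- The ring `R_A^0` of maps on cofinite subsets of `A` modulo agreement on cofinite
subsets is the ring of germs along `cofinOn Λ A`; this is the canonical map to it. -/
def germHom (A : Set Λ) : (Λ → k) →+* (cofinOn Λ A).Germ k := Filter.Germ.coeRingHom _

/-- The subring of `R_A^0` generated over `k` by the coefficient ratios of the `Q j`. -/
def SG {M q : ℕ} (A : Set Λ) (Q : Fin q → Λ → MvPolynomial (Fin (M + 1)) k)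
    (Ij : Fin q → (Fin (M + 1) →₀ ℕ)) : Subring ((cofinOn Λ A).Germ k) :=
  (kQRing Q Ij).map (germHom A)

/-- The field `R_{A,Q}`: the total fraction ring of the subring of `R_A^0` generated
over `k` by the coefficient ratios (a field, i.e. the field of fractions, when `A` is
coherent, since then this subring is an integral domain). -/
def RAQ {M q : ℕ} (A : Set Λ) (Q : Fin q → Λ → MvPolynomial (Fin (M + 1)) k)
    (Ij : Fin q → (Fin (M + 1) →₀ ℕ)) : Type :=
  FractionRing ↥(SG A Q Ij)

instance instCommRingRAQ {M q : ℕ} (A : Set Λ) (Q : Fin q → Λ → MvPolynomial (Fin (M + 1)) k)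
    (Ij : Fin q → (Fin (M + 1) →₀ ℕ)) : CommRing (RAQ A Q Ij) :=
  inferInstanceAs (CommRing (FractionRing ↥(SG A Q Ij)))

instance instAlgebraRAQ {M q : ℕ} (A : Set Λ) (Q : Fin q → Λ → MvPolynomial (Fin (M + 1)) k)
    (Ij : Fin q → (Fin (M + 1) →₀ ℕ)) : Algebra ↥(SG A Q Ij) (RAQ A Q Ij) :=
  inferInstanceAs (Algebra ↥(SG A Q Ij) (FractionRing ↥(SG A Q Ij)))

/-- The element of `R_{A,Q}` determined by a function in `kQRing`. -/
def toRAQ {M q : ℕ} (A : Set Λ) (Q : Fin q → Λ → MvPolynomial (Fin (M + 1)) k)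
    (Ij : Fin q → (Fin (M + 1) →₀ ℕ)) (f : Λ → k) (hf : f ∈ kQRing Q Ij) : RAQ A Q Ij :=
  algebraMap (SG A Q Ij) (RAQ A Q Ij) ⟨germHom A f, Subring.mem_map.mpr ⟨f, hf, rfl⟩⟩

/-- The embedding of `k` into `R_{A,Q}` as constants. -/
def kToRAQ {M q : ℕ} (A : Set Λ) (Q : Fin q → Λ → MvPolynomial (Fin (M + 1)) k)
    (Ij : Fin q → (Fin (M + 1) →₀ ℕ)) : k →+* RAQ A Q Ij :=
  (algebraMap (SG A Q Ij) (RAQ A Q Ij)).comp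
    (((germHom A).comp (Pi.constRingHom Λ k)).codRestrict (SG A Q Ij) fun c =>
      Subring.mem_map.mpr ⟨_, Subring.subset_closure (Or.inl ⟨c, rfl⟩), rfl⟩)

/-- The coefficient ratio `a_{j,I}/a_{j,I_j}` as an element of `R_{A,Q}`. -/
def ratioRAQ {M q : ℕ} (A : Set Λ) (Q : Fin q → Λ → MvPolynomial (Fin (M + 1)) k)
    (Ij : Fin q → (Fin (M + 1) →₀ ℕ)) (j : Fin q) (I : Fin (M + 1) →₀ ℕ) : RAQ A Q Ij :=
  toRAQ A Q Ij (ratioFun Q Ij j I) (Subring.subset_closure (Or.inr ⟨j, I, rfl⟩))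

/-- `â : Λ → k` is a special representative of `a ∈ R_{A,Q}` if `â = b/c` pointwise for
functions `b, c` in the ring generated by the coefficient ratios, with `c(α) ≠ 0` for all
but finitely many `α ∈ A` and `a = [b]/[c]` in `R_{A,Q}`. -/
def IsSpecialRep {M q : ℕ} (A : Set Λ) (Q : Fin q → Λ → MvPolynomial (Fin (M + 1)) k)
    (Ij : Fin q → (Fin (M + 1) →₀ ℕ)) (a : RAQ A Q Ij) (ahat : Λ → k) : Prop :=
  ∃ (b c : Λ → k) (hb : b ∈ kQRing Q Ij) (hc : c ∈ kQRing Q Ij),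
    (∀ᶠ α in cofinOn Λ A, c α ≠ 0) ∧
    toRAQ A Q Ij b hb = a * toRAQ A Q Ij c hc ∧
    ahat = fun α => b α / c α

/-- A special representative of a polynomial with coefficients in `R_{A,Q}`. -/
def IsPolyRep {M q : ℕ} (A : Set Λ) (Q : Fin q → Λ → MvPolynomial (Fin (M + 1)) k)
    (Ij : Fin q → (Fin (M + 1) →₀ ℕ)) (P : MvPolynomial (Fin (M + 1)) (RAQ A Q Ij))
    (Phat : Λ → MvPolynomial (Fin (M + 1)) k) : Prop :=
  ∀ I, IsSpecialRep A Q Ij (MvPolynomial.coeff I P) fun α => MvPolynomial.coeff I (Phat α)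

/-- The evaluation `W(α)` of a subspace `W ⊆ R_{A,Q}[x_0,…,x_M]` at `α`: the `k`-subspace
spanned by all evaluations at `α` of special representatives of elements of `W`. -/
def evalSubspace {M q : ℕ} (A : Set Λ) (Q : Fin q → Λ → MvPolynomial (Fin (M + 1)) k)
    (Ij : Fin q → (Fin (M + 1) →₀ ℕ))
    (W : Submodule (RAQ A Q Ij) (MvPolynomial (Fin (M + 1)) (RAQ A Q Ij))) (α : Λ) :
    Submodule k (MvPolynomial (Fin (M + 1)) k) :=
  Submodule.span k
    {p | ∃ P ∈ W, ∃ Phat, IsPolyRep A Q Ij P Phat ∧ p = Phat α}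

/-- The ideal `I_{A,Q}(V)` of `R_{A,Q}[x_0,…,x_M]` generated by the ideal `I(V)`. -/
def IAQV {M q : ℕ} (A : Set Λ) (Q : Fin q → Λ → MvPolynomial (Fin (M + 1)) k)
    (Ij : Fin q → (Fin (M + 1) →₀ ℕ)) (IV : Ideal (MvPolynomial (Fin (M + 1)) k)) :
    Ideal (MvPolynomial (Fin (M + 1)) (RAQ A Q Ij)) :=
  Ideal.map (MvPolynomial.map (kToRAQ A Q Ij)) IV

/-- The family `Q` is `V`-admissible: for each choice of `n+1` of the moving
hypersurfaces, for all but finitely many `α` they have no common zero on `V(k̄)`. -/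
def Admissible {M q : ℕ} (IV : Ideal (MvPolynomial (Fin (M + 1)) k))
    (Q : Fin q → Λ → MvPolynomial (Fin (M + 1)) k) (n : ℕ) : Prop :=
  ∀ J : Finset (Fin q), J.card = n + 1 →
    {α : Λ | ∃ x : Fin (M + 1) → AlgebraicClosure k, x ≠ 0 ∧
      (∀ P ∈ IV, MvPolynomial.eval x
        (MvPolynomial.map (algebraMap k (AlgebraicClosure k)) P) = 0) ∧
      (∀ j ∈ J, MvPolynomial.eval x
        (MvPolynomial.map (algebraMap k (AlgebraicClosure k)) (Q j α)) = 0)}.Finite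

/-- The set `L_N^I`. -/
def LNIset {R : Type} [CommRing R] {σ : Type} {n : ℕ} (Qn : Fin n → MvPolynomial σ R)
    (J : Ideal (MvPolynomial σ R)) (d : ℕ) (I : Fin n → ℕ) (N : ℕ) :
    Set (MvPolynomial σ R) :=
  {γ | γ ∈ homogeneousSubmodule σ R (N - d * ∑ i, I i) ∧
    ∃ γE : (Fin n → ℕ) → MvPolynomial σ R,
      (∀ E, γE E ∈ homogeneousSubmodule σ R (N - d * ∑ i, E i)) ∧
      (∀ E, γE E ≠ 0 → toLex I < toLex E ∧ d * ∑ i, E i ≤ N) ∧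
      {E | γE E ≠ 0}.Finite ∧
      (∏ s, Qn s ^ I s) * γ - ∑ᶠ E, (∏ s, Qn s ^ E s) * γE E ∈ J}

/-- The homogeneous ideal `L^I` generated by `⋃_{N ≥ d‖I‖} L_N^I`. -/
def LIdeal {R : Type} [CommRing R] {σ : Type} {n : ℕ} (Qn : Fin n → MvPolynomial σ R)
    (J : Ideal (MvPolynomial σ R)) (d : ℕ) (I : Fin n → ℕ) : Ideal (MvPolynomial σ R) :=
  Ideal.span (⋃ N ∈ {N : ℕ | d * ∑ i, I i ≤ N}, LNIset Qn J d I N)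

/-- `m_N^I`, the dimension over `R_{A,Q}` of `R_{A,Q}[x_0,…,x_M]_{N-d‖I‖} / L_N^I`. -/
def mNI {R : Type} [CommRing R] {σ : Type} {n : ℕ} (Qn : Fin n → MvPolynomial σ R)
    (J : Ideal (MvPolynomial σ R)) (d : ℕ) (I : Fin n → ℕ) (N : ℕ) : ℕ :=
  Module.finrank R
    ↥(Submodule.map (Submodule.span R (LNIset Qn J d I N)).mkQ
      (homogeneousSubmodule σ R (N - d * ∑ i, I i)))

/-- The dimension of the degree-`N` part of the quotient of the polynomial ring by the
ideal `J`; for `J = I(V)` this is the Hilbert function `H_V(N)`. -/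
def hilbert {R : Type} [CommRing R] {σ : Type} (J : Ideal (MvPolynomial σ R)) (N : ℕ) :
    ℕ :=
  Module.finrank R
    ↥(Submodule.map (Submodule.restrictScalars R J).mkQ (homogeneousSubmodule σ R N))

end

end MovingTargets

namespace MovingTargets

/-- A monotone map from a well-quasi-ordered type to a partial order with the ascending chain
condition has finite range. -/
theorem finite_range_of_monotone {α β : Type*} [Preorder α]
    [WellQuasiOrderedLE α] [PartialOrder β] [WellFoundedGT β] {f : α → β} (hf : Monotone f) :
    (Set.range f).Finite := by
  by_contra hinf
  have hinf : (Set.range f).Infinite := hinf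
  let e := hinf.natEmbedding
  choose a ha using fun m => (e m).2
  obtain ⟨g, hg⟩ := (wellQuasiOrdered_le (α := α)).exists_monotone_subseq a
  have hmono : StrictMono fun m => f (a (g m)) := by
    refine Monotone.strictMono_of_injective (fun m p hmp => hf (hg m p hmp)) fun m p hmp => ?_
    simp only [ha] at hmp
    exact g.injective (e.injective (Subtype.ext hmp))
  obtain ⟨m, hm⟩ := WellFoundedGT.monotone_chain_condition ⟨_, hmono.monotone⟩
  exact (hmono (Nat.lt_succ_self m)).ne (hm (m + 1) m.le_succ)

theorem LNIset_subset_of_le {R : Type} [CommRing R] {σ : Type} {n : ℕ}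
    (Qn : Fin n → MvPolynomial σ R) (J : Ideal (MvPolynomial σ R)) (d : ℕ) (I D : Fin n → ℕ)
    (N : ℕ) : LNIset Qn J d I N ⊆ LNIset Qn J d (I + D) (N + d * ∑ i, D i) := by
  have hsum (E : Fin n → ℕ) : N + d * ∑ i, D i - d * ∑ i, (E + D) i = N - d * ∑ i, E i := by
    simp only [Pi.add_apply, Finset.sum_add_distrib, mul_add]
    omega
  rintro γ ⟨hγ, γE, hhom, hlt, hfin, hmem⟩
  have hinj : Function.Injective fun E : Fin n → ℕ => E + D := add_left_injective D
  let γ' : (Fin n → ℕ) → MvPolynomial σ R := Function.extend (fun E : Fin n → ℕ => E + D) γE 0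
  have hγ' (E) : γ' (E + D) = γE E := hinj.extend_apply _ _ E
  have hγ_zero (F) (hF : ¬∃ E, E + D = F) : γ' F = 0 := Function.extend_apply' _ _ _ hF
  have hsupp (F) (hF : γ' F ≠ 0) : ∃ E, E + D = F := not_imp_comm.1 (hγ_zero F) hF
  refine ⟨by rwa [hsum], γ', fun F => ?_, fun F hF => ?_, ?_, ?_⟩
  · by_cases hF : ∃ E, E + D = F
    · obtain ⟨E, rfl⟩ := hF
      rw [hγ', hsum]
      exact hhom E
    · rw [hγ_zero F hF]
      exact zero_mem _
  · obtain ⟨E, rfl⟩ := hsupp F hF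
    rw [hγ'] at hF
    obtain ⟨h₁, h₂⟩ := hlt E hF
    refine ⟨?_, ?_⟩
    · rw [toLex_add, toLex_add]
      exact add_lt_add_left h₁ _
    · simp only [Pi.add_apply, Finset.sum_add_distrib, mul_add]
      omega
  · refine (hfin.image fun E => E + D).subset fun F hF => ?_
    obtain ⟨E, rfl⟩ := hsupp F hF
    exact ⟨E, by simpa only [Set.mem_ofPred_eq, hγ'] using hF, rfl⟩
  · have hprod (E : Fin n → ℕ) :
        ∏ s, Qn s ^ (E + D) s = (∏ s, Qn s ^ D s) * ∏ s, Qn s ^ E s := by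
      simp only [Pi.add_apply, pow_add, Finset.prod_mul_distrib, mul_comm]
    have hsumF : ∑ᶠ F, (∏ s, Qn s ^ F s) * γ' F =
        (∏ s, Qn s ^ D s) * ∑ᶠ E, (∏ s, Qn s ^ E s) * γE E := by
      have hs : (Function.support fun E => (∏ s, Qn s ^ E s) * γE E).Finite :=
        hfin.subset fun E hE => right_ne_zero_of_mul hE
      have hs' : (Function.support fun F => (∏ s, Qn s ^ F s) * γ' F) ⊆
          Set.range fun E : Fin n → ℕ => E + D :=
        fun F hF => hsupp F (right_ne_zero_of_mul hF)
      rw [mul_finsum' _ _ hs, ← finsum_mem_univ fun F => (∏ s, Qn s ^ F s) * γ' F,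
        finsum_mem_inter_support_eq _ _ (Set.range fun E : Fin n → ℕ => E + D)
          (by rw [Set.univ_inter, Set.inter_eq_right.2 hs']),
        finsum_mem_range hinj]
      exact finsum_congr fun E => by rw [hγ', hprod, mul_assoc]
    rw [hprod, hsumF, mul_assoc, ← mul_sub]
    exact J.mul_mem_left _ hmem

theorem LIdeal_mono {R : Type} [CommRing R] {σ : Type} {n : ℕ}
    (Qn : Fin n → MvPolynomial σ R) (J : Ideal (MvPolynomial σ R)) (d : ℕ) :
    Monotone (LIdeal Qn J d) := by
  intro I I' hI
  obtain ⟨D, rfl⟩ := exists_add_of_le hI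
  refine Ideal.span_mono (Set.iUnion₂_subset fun N hN => ?_)
  refine (LNIset_subset_of_le Qn J d I D N).trans
    (Set.subset_biUnion_of_mem (u := LNIset Qn J d (I + D)) ?_)
  simp only [Set.mem_ofPred_eq, Pi.add_apply, Finset.sum_add_distrib, mul_add] at hN ⊢
  omega

theorem finite_ratioFun {k Λ : Type} [Field k] {M q : ℕ}
    (Q : Fin q → Λ → MvPolynomial (Fin (M + 1)) k) (Ij : Fin q → (Fin (M + 1) →₀ ℕ)) {d : ℕ}
    (hQ : ∀ j α, (Q j α).IsHomogeneous d) : {f | ∃ j I, f = ratioFun Q Ij j I}.Finite := by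
  have hdeg : {I : Fin (M + 1) →₀ ℕ | I.degree = d}.Finite :=
    (Finsupp.finite_of_degree_le d).subset fun I hI => le_of_eq hI
  refine (((Set.finite_univ.prod hdeg).image fun p : Fin q × (Fin (M + 1) →₀ ℕ) =>
    ratioFun Q Ij p.1 p.2).insert 0).subset ?_
  rintro _ ⟨j, I, rfl⟩
  by_cases hI : I.degree = d
  · exact Or.inr ⟨(j, I), ⟨trivial, hI⟩, rfl⟩
  · refine Or.inl (funext fun α => ?_)
    simp [ratioFun, (hQ j α).coeff_eq_zero hI]

theorem isNoetherianRing_RAQ {k Λ : Type} [Field k] {M q : ℕ} (A : Set Λ)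
    (Q : Fin q → Λ → MvPolynomial (Fin (M + 1)) k) (Ij : Fin q → (Fin (M + 1) →₀ ℕ)) {d : ℕ}
    (hQ : ∀ j α, (Q j α).IsHomogeneous d) : IsNoetherianRing (RAQ A Q Ij) := by
  have hadj : (Algebra.adjoin k {f | ∃ j I, f = ratioFun Q Ij j I}).toSubring = kQRing Q Ij :=
    Algebra.adjoin_eq_ring_closure _
  have hk : IsNoetherianRing (kQRing Q Ij) := by
    rw [← hadj]
    have : Algebra.FiniteType k (Algebra.adjoin k {f | ∃ j I, f = ratioFun Q Ij j I}) :=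
      .adjoin_of_finite (finite_ratioFun Q Ij hQ)
    exact Algebra.FiniteType.isNoetherianRing k
      (Algebra.adjoin k {f | ∃ j I, f = ratioFun Q Ij j I})
  have hS : IsNoetherianRing (SG A Q Ij) :=
    isNoetherianRing_of_surjective (kQRing Q Ij) _
      (((germHom A).comp (kQRing Q Ij).subtype).codRestrict (SG A Q Ij) fun f =>
        Subring.mem_map.2 ⟨f, f.2, rfl⟩)
      (by
        rintro ⟨_, f, hf, rfl⟩
        exact ⟨⟨f, hf⟩, rfl⟩)
  exact IsLocalization.isNoetherianRing (nonZeroDivisors (SG A Q Ij))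
    (FractionRing (SG A Q Ij)) hS

end MovingTargets

set_option maxHeartbeats 1000000 in
open MovingTargets Filter MvPolynomial in
/-- The set of ideals `{L^I : I ∈ ℕ₀ⁿ}` of `R_{A,Q}[x_0,…,x_M]`
is finite. -/
theorem finitely_many_LIdeals
    {k Λ : Type} [Field k] [NumberField k] {M q : ℕ}
    (hq : 0 < q)
    (Q : Fin q → Λ → MvPolynomial (Fin (M + 1)) k)
    (d : ℕ) (hd : 0 < d)
    (hQhom : ∀ j α, (Q j α).IsHomogeneous d)
    (hQne : ∀ j α, Q j α ≠ 0)
    (A : Set Λ) (hA : A.Infinite) (hcoh : Coherent A Q)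
    (Ij : Fin q → (Fin (M + 1) →₀ ℕ))
    (hIj : ∀ j, ∀ᶠ α in cofinOn Λ A, MvPolynomial.coeff (Ij j) (Q j α) ≠ 0)
    (QR : Fin q → MvPolynomial (Fin (M + 1)) (RAQ A Q Ij))
    (hQR : ∀ j I, MvPolynomial.coeff I (QR j) = ratioRAQ A Q Ij j I)
    {n : ℕ} (hnq : n ≤ q)
    (IV : Ideal (MvPolynomial (Fin (M + 1)) k)) (hIVprime : IV.IsPrime)
    (hIVhom : ∃ G : Set (MvPolynomial (Fin (M + 1)) k),
      (∀ g ∈ G, ∃ m, g.IsHomogeneous m) ∧ Ideal.span G = IV)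
    (hdim : ringKrullDim (MvPolynomial (Fin (M + 1)) k ⧸ IV) = (n : ℕ) + 1)
    :
    {L : Ideal (MvPolynomial (Fin (M + 1)) (RAQ A Q Ij)) |
      ∃ I : Fin n → ℕ,
        L = LIdeal (fun s : Fin n => QR (Fin.castLE hnq s)) (IAQV A Q Ij IV) d I}.Finite := by
  have := isNoetherianRing_RAQ A Q Ij hQhom
  refine (finite_range_of_monotone (LIdeal_mono
    (fun s : Fin n => QR (Fin.castLE hnq s)) (IAQV A Q Ij IV) d)).subset ?_
  rintro _ ⟨I, rfl⟩
  exact ⟨I, rfl⟩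
end

section
/- Fix N ∈ ℕ and for each I ∈ τ_N choose γ_{I1},…,γ_{I m_N^I} ∈ R_{A,Q}[x_0,…,x_M]_{N−d‖I‖} whose classes form a basis of the R_{A,Q}-vector space R_{A,Q}[x_0,…,x_M]_{N−d‖I‖}/L_N^I. Then the classes [Q_1^{i_1}⋯Q_n^{i_n}·γ_{I1}],…,[Q_1^{i_1}⋯Q_n^{i_n}·γ_{I m_N^I}], for I = (i_1,…,i_n) ranging over τ_N, form a basis of the R_{A,Q}-vector space R_{A,Q}[x_0,…,x_M]_N/I_{A,Q}(V)_N. -/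
open Filter MvPolynomial

open MovingTargets MvPolynomial

namespace MovingTargets

section LexFiltration

variable {R σ : Type} [CommRing R] {n : ℕ}

/-- The products `Q₁^{e₁}⋯Qₙ^{eₙ}·γ` with `γ` homogeneous of degree `N - d‖E‖`. -/
noncomputable def monomialPiece (Qn : Fin n → MvPolynomial σ R) (d N : ℕ) (E : Fin n → ℕ) :
    Submodule R (MvPolynomial σ R) :=
  (homogeneousSubmodule σ R (N - d * ∑ i, E i)).map (LinearMap.mulLeft R (∏ s, Qn s ^ E s))

/-- The sum of the pieces `monomialPiece Qn d N E` over `E ∈ τ_N` lexicographically larger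
than `I`. -/
noncomputable def lexTail (Qn : Fin n → MvPolynomial σ R) (d N : ℕ) (I : Fin n → ℕ) :
    Submodule R (MvPolynomial σ R) :=
  ⨆ E : {E : Fin n → ℕ // toLex I < toLex E ∧ d * ∑ i, E i ≤ N}, monomialPiece Qn d N E

/-- `L_N^I` as a submodule. -/
noncomputable def LNI (Qn : Fin n → MvPolynomial σ R) (J : Ideal (MvPolynomial σ R)) (d : ℕ)
    (I : Fin n → ℕ) (N : ℕ) : Submodule R (MvPolynomial σ R) :=
  homogeneousSubmodule σ R (N - d * ∑ i, I i) ⊓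
    (J.restrictScalars R ⊔ lexTail Qn d N I).comap (LinearMap.mulLeft R (∏ s, Qn s ^ I s))

theorem mul_mem_monomialPiece {Qn : Fin n → MvPolynomial σ R} {d N : ℕ} {E : Fin n → ℕ}
    {p : MvPolynomial σ R} (hp : p ∈ homogeneousSubmodule σ R (N - d * ∑ i, E i)) :
    (∏ s, Qn s ^ E s) * p ∈ monomialPiece Qn d N E :=
  ⟨p, hp, rfl⟩

theorem monomialPiece_le_lexTail (Qn : Fin n → MvPolynomial σ R) {d N : ℕ} {I E : Fin n → ℕ}
    (hIE : toLex I < toLex E) (hE : d * ∑ i, E i ≤ N) :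
    monomialPiece Qn d N E ≤ lexTail Qn d N I :=
  le_iSup (fun E : {E : Fin n → ℕ // toLex I < toLex E ∧ d * ∑ i, E i ≤ N} =>
    monomialPiece Qn d N E) ⟨E, hIE, hE⟩

theorem LNIset_eq_coe_LNI (Qn : Fin n → MvPolynomial σ R) (J : Ideal (MvPolynomial σ R))
    (d : ℕ) (I : Fin n → ℕ) (N : ℕ) : LNIset Qn J d I N = LNI Qn J d I N := by
  classical
  ext p
  simp only [LNIset, LNI, Set.mem_ofPred_eq, SetLike.mem_coe, Submodule.mem_inf,
    Submodule.mem_comap, LinearMap.mulLeft_apply]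
  refine and_congr_right fun _ => ⟨?_, fun h => ?_⟩
  · rintro ⟨γE, hhom, hsupp, -, hJ⟩
    rw [← sub_add_cancel ((∏ s, Qn s ^ I s) * p) (∑ᶠ E, (∏ s, Qn s ^ E s) * γE E)]
    refine Submodule.add_mem_sup hJ
      (finsum_induction (· ∈ lexTail Qn d N I) (zero_mem _) (fun _ _ => add_mem) fun E => ?_)
    by_cases hE : γE E = 0
    · simp [hE]
    · exact monomialPiece_le_lexTail Qn (hsupp E hE).1 (hsupp E hE).2
        (mul_mem_monomialPiece (hhom E))
  · obtain ⟨a, ha, b, hb, hab⟩ := Submodule.mem_sup.1 h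
    obtain ⟨f, hf, rfl⟩ := (Submodule.mem_iSup_iff_exists_finsupp _ _).1 hb
    choose g hg hgf using hf
    let γE : (Fin n → ℕ) → MvPolynomial σ R := fun E =>
      if h : toLex I < toLex E ∧ d * ∑ i, E i ≤ N then if f ⟨E, h⟩ = 0 then 0 else g ⟨E, h⟩
      else 0
    have hne : ∀ E, γE E ≠ 0 → ∃ h : toLex I < toLex E ∧ d * ∑ i, E i ≤ N, f ⟨E, h⟩ ≠ 0 := by
      intro E hE
      by_cases h : toLex I < toLex E ∧ d * ∑ i, E i ≤ N
      · exact ⟨h, fun h0 => hE (by simp [γE, h0])⟩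
      · exact absurd (by simp [γE, h]) hE
    have hsub : {E | γE E ≠ 0} ⊆ ((f.support.image Subtype.val : Finset _) : Set _) := by
      intro E hE
      obtain ⟨h, h0⟩ := hne E hE
      exact Finset.mem_coe.2 (Finset.mem_image.2 ⟨⟨E, h⟩, by simpa using h0, rfl⟩)
    refine ⟨γE, fun E => ?_, fun E hE => (hne E hE).1, (Finset.finite_toSet _).subset hsub, ?_⟩
    · simp only [γE]
      split_ifs with h h0
      · exact zero_mem _
      · exact hg ⟨E, h⟩
      · exact zero_mem _
    · have hsum : ∑ᶠ E, (∏ s, Qn s ^ E s) * γE E = f.sum fun _ x => x := by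
        rw [finsum_eq_sum_of_support_subset (s := f.support.image Subtype.val) _
          (fun E hE => hsub fun h0 => hE (by simp [h0])),
          Finset.sum_image Subtype.val_injective.injOn]
        refine Finset.sum_congr rfl fun E hE => ?_
        rw [← hgf E]
        simp only [γE, dif_pos E.2, Finsupp.mem_support_iff.1 hE, if_false,
          LinearMap.mulLeft_apply]
      rw [hsum, ← hab, add_sub_cancel_right]
      exact ha

theorem span_LNIset (Qn : Fin n → MvPolynomial σ R) (J : Ideal (MvPolynomial σ R))
    (d : ℕ) (I : Fin n → ℕ) (N : ℕ) :
    Submodule.span R (LNIset Qn J d I N) = LNI Qn J d I N := by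
  rw [LNIset_eq_coe_LNI, Submodule.span_eq]

theorem finite_setOf_mul_sum_le {d : ℕ} (hd : 0 < d) (N : ℕ) :
    Finite {I : Fin n → ℕ // d * ∑ i, I i ≤ N} := by
  refine ((Set.finite_Iic fun _ : Fin n => N).subset fun I hI i => ?_).to_subtype
  exact (Finset.single_le_sum (fun _ _ => Nat.zero_le _) (Finset.mem_univ i)).trans
    ((Nat.le_mul_of_pos_left _ hd).trans hI)

theorem linearIndependent_monomial_mul (Qn : Fin n → MvPolynomial σ R)
    (J : Ideal (MvPolynomial σ R)) {d : ℕ} (hd : 0 < d) (N : ℕ) (m : (Fin n → ℕ) → ℕ)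
    (γ : (I : Fin n → ℕ) → Fin (m I) → MvPolynomial σ R)
    (hγmem : ∀ I : Fin n → ℕ, d * ∑ i, I i ≤ N → ∀ ℓ,
      γ I ℓ ∈ homogeneousSubmodule σ R (N - d * ∑ i, I i))
    (hγli : ∀ I : Fin n → ℕ, d * ∑ i, I i ≤ N →
      LinearIndependent R fun ℓ => (LNI Qn J d I N).mkQ (γ I ℓ)) :
    LinearIndependent R fun p : (I : {I : Fin n → ℕ // d * ∑ i, I i ≤ N}) × Fin (m I.1) =>
      (J.restrictScalars R).mkQ ((∏ s, Qn s ^ p.1.1 s) * γ p.1.1 p.2) := by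
  classical
  have := finite_setOf_mul_sum_le (n := n) hd N
  have := Fintype.ofFinite {I : Fin n → ℕ // d * ∑ i, I i ≤ N}
  rw [Fintype.linearIndependent_iff]
  intro g hg
  let h : {I : Fin n → ℕ // d * ∑ i, I i ≤ N} → MvPolynomial σ R := fun E =>
    ∑ ℓ, g ⟨E, ℓ⟩ • γ E.1 ℓ
  have hhom : ∀ E, h E ∈ homogeneousSubmodule σ R (N - d * ∑ i, E.1 i) := fun E =>
    sum_mem fun ℓ _ => Submodule.smul_mem _ _ (hγmem _ E.2 ℓ)
  have hJ : ∑ E, (∏ s, Qn s ^ E.1 s) * h E ∈ J.restrictScalars R := by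
    rw [← Submodule.Quotient.mk_eq_zero, ← Submodule.mkQ_apply, ← hg, Fintype.sum_sigma]
    simp only [h, map_sum, Finset.mul_sum, mul_smul_comm, map_smul]
  suffices H : ∀ I : Lex (Fin n → ℕ), ∀ hI : d * ∑ i, ofLex I i ≤ N, ∀ ℓ,
      g ⟨⟨ofLex I, hI⟩, ℓ⟩ = 0 from fun p => H (toLex p.1.1) p.1.2 p.2
  intro I
  induction I using WellFoundedLT.induction with
  | ind I ih =>
    intro hI
    let I' : {I : Fin n → ℕ // d * ∑ i, I i ≤ N} := ⟨ofLex I, hI⟩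
    have hmem : h I' ∈ LNI Qn J d (ofLex I) N := by
      refine ⟨hhom I', ?_⟩
      rw [← Finset.add_sum_erase _ _ (Finset.mem_univ I')] at hJ
      rw [SetLike.mem_coe, Submodule.mem_comap, LinearMap.mulLeft_apply, ← add_sub_cancel_right
        ((∏ s, Qn s ^ I'.1 s) * h I') (∑ E ∈ Finset.univ.erase I', (∏ s, Qn s ^ E.1 s) * h E),
        sub_eq_add_neg]
      refine Submodule.add_mem_sup hJ (neg_mem (sum_mem fun E hE => ?_))
      rcases lt_trichotomy (toLex E.1) I with hlt | heq | hgt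
      · have : h E = 0 := Finset.sum_eq_zero fun ℓ _ => by
          rw [show g ⟨E, ℓ⟩ = 0 from ih (toLex E.1) hlt E.2 ℓ, zero_smul]
        simp [this]
      · exact absurd (Subtype.ext heq) (Finset.ne_of_mem_erase hE)
      · exact monomialPiece_le_lexTail Qn hgt E.2 (mul_mem_monomialPiece (hhom E))
    refine Fintype.linearIndependent_iff.1 (hγli _ hI) (fun ℓ => g ⟨I', ℓ⟩) ?_
    rw [← Submodule.Quotient.mk_eq_zero, ← Submodule.mkQ_apply] at hmem
    simpa only [h, map_sum, map_smul] using hmem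

theorem prod_pow_mul_mem_homogeneousSubmodule {Qn : Fin n → MvPolynomial σ R} {d N : ℕ}
    (hQn : ∀ s, (Qn s).IsHomogeneous d) {E : Fin n → ℕ} (hE : d * ∑ i, E i ≤ N)
    {p : MvPolynomial σ R} (hp : p ∈ homogeneousSubmodule σ R (N - d * ∑ i, E i)) :
    (∏ s, Qn s ^ E s) * p ∈ homogeneousSubmodule σ R N := by
  have h := (IsHomogeneous.prod Finset.univ _ _ fun s _ => (hQn s).pow (E s)).mul hp
  rwa [← Finset.mul_sum, Nat.add_sub_cancel' hE] at h

theorem span_monomial_mul (Qn : Fin n → MvPolynomial σ R) (J : Ideal (MvPolynomial σ R))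
    {d : ℕ} (hd : 0 < d) (hQn : ∀ s, (Qn s).IsHomogeneous d) (N : ℕ) (m : (Fin n → ℕ) → ℕ)
    (γ : (I : Fin n → ℕ) → Fin (m I) → MvPolynomial σ R)
    (hγmem : ∀ I : Fin n → ℕ, d * ∑ i, I i ≤ N → ∀ ℓ,
      γ I ℓ ∈ homogeneousSubmodule σ R (N - d * ∑ i, I i))
    (hγspan : ∀ I : Fin n → ℕ, d * ∑ i, I i ≤ N →
      Submodule.span R (Set.range fun ℓ => (LNI Qn J d I N).mkQ (γ I ℓ)) =
        (homogeneousSubmodule σ R (N - d * ∑ i, I i)).map (LNI Qn J d I N).mkQ) :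
    Submodule.span R
      (Set.range fun p : (I : {I : Fin n → ℕ // d * ∑ i, I i ≤ N}) × Fin (m I.1) =>
        (J.restrictScalars R).mkQ ((∏ s, Qn s ^ p.1.1 s) * γ p.1.1 p.2)) =
      (homogeneousSubmodule σ R N).map (J.restrictScalars R).mkQ := by
  refine le_antisymm (Submodule.span_le.2 ?_) ?_
  · rintro _ ⟨p, rfl⟩
    exact Submodule.mem_map_of_mem
      (prod_pow_mul_mem_homogeneousSubmodule hQn p.1.2 (hγmem _ p.1.2 _))
  set S := Submodule.span R
      (Set.range fun p : (I : {I : Fin n → ℕ // d * ∑ i, I i ≤ N}) × Fin (m I.1) =>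
        (J.restrictScalars R).mkQ ((∏ s, Qn s ^ p.1.1 s) * γ p.1.1 p.2))
  let τ := {I : Lex (Fin n → ℕ) // d * ∑ i, ofLex I i ≤ N}
  have : Finite τ := finite_setOf_mul_sum_le (n := n) hd N
  have key : ∀ I : τ, monomialPiece Qn d N (ofLex I.1) ≤ S.comap (J.restrictScalars R).mkQ := by
    intro I
    induction I using WellFoundedGT.induction with
    | ind I ih =>
      rintro _ ⟨p, hp, rfl⟩
      have hmap := Submodule.mem_map_of_mem (f := (LNI Qn J d (ofLex I.1) N).mkQ) hp
      rw [← hγspan _ I.2, Set.range_comp', ← Submodule.map_span] at hmap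
      obtain ⟨r, hr, hrp⟩ := hmap
      have hr' : Submodule.span R (Set.range (γ (ofLex I.1))) ≤
          (S.comap (J.restrictScalars R).mkQ).comap
            (LinearMap.mulLeft R (∏ s, Qn s ^ ofLex I.1 s)) := by
        rw [Submodule.span_le]
        rintro _ ⟨ℓ, rfl⟩
        exact Submodule.subset_span ⟨⟨⟨ofLex I.1, I.2⟩, ℓ⟩, rfl⟩
      have hpr : p - r ∈ LNI Qn J d (ofLex I.1) N :=
        (Submodule.Quotient.eq _).1 hrp.symm
      have hle : J.restrictScalars R ⊔ lexTail Qn d N (ofLex I.1) ≤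
          S.comap (J.restrictScalars R).mkQ :=
        sup_le (Submodule.le_comap_mkQ _ _)
          (iSup_le fun E => ih ⟨toLex E.1, E.2.2⟩ E.2.1)
      have h := add_mem (hle hpr.2) (hr' hr)
      rwa [← map_add, sub_add_cancel] at h
  have hzero := key ⟨toLex fun _ => 0, by simp⟩
  rw [Submodule.map_le_iff_le_comap]
  intro p hp
  exact hzero ⟨p, by simpa using hp, by simp⟩

end LexFiltration

theorem ratioRAQ_eq_zero {k Λ : Type} [Field k] {M q : ℕ} {A : Set Λ}
    {Q : Fin q → Λ → MvPolynomial (Fin (M + 1)) k} {Ij : Fin q → (Fin (M + 1) →₀ ℕ)}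
    {j : Fin q} {I : Fin (M + 1) →₀ ℕ} (h : ∀ α, coeff I (Q j α) = 0) :
    ratioRAQ A Q Ij j I = 0 := by
  have h0 : ratioFun Q Ij j I = 0 := funext fun α => by simp [ratioFun, h α]
  unfold ratioRAQ toRAQ
  simp only [h0, map_zero]
  exact map_zero _

end MovingTargets

set_option maxHeartbeats 1000000 in
open MovingTargets Filter MvPolynomial in
/-- (Lemma 2.6.) If for each `I ∈ τ_N` the classes of
`γ_{I,1},…,γ_{I,m_N^I} ∈ R_{A,Q}[x_0,…,x_M]_{N−d‖I‖}` form a basis of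
`R_{A,Q}[x_0,…,x_M]_{N−d‖I‖}/L_N^I`, then the classes
`[Q_1^{i_1}⋯Q_n^{i_n}·γ_{I,ℓ}]` for `I ∈ τ_N`, `1 ≤ ℓ ≤ m_N^I`, form a basis of
`R_{A,Q}[x_0,…,x_M]_N / I_{A,Q}(V)_N`. -/
theorem basis_of_quotient_by_IAQV
    {k Λ : Type} [Field k] [NumberField k] {M q : ℕ}
    (hq : 0 < q)
    (Q : Fin q → Λ → MvPolynomial (Fin (M + 1)) k)
    (d : ℕ) (hd : 0 < d)
    (hQhom : ∀ j α, (Q j α).IsHomogeneous d)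
    (hQne : ∀ j α, Q j α ≠ 0)
    (A : Set Λ) (hA : A.Infinite) (hcoh : Coherent A Q)
    (Ij : Fin q → (Fin (M + 1) →₀ ℕ))
    (hIj : ∀ j, ∀ᶠ α in cofinOn Λ A, MvPolynomial.coeff (Ij j) (Q j α) ≠ 0)
    (QR : Fin q → MvPolynomial (Fin (M + 1)) (RAQ A Q Ij))
    (hQR : ∀ j I, MvPolynomial.coeff I (QR j) = ratioRAQ A Q Ij j I)
    {n : ℕ} (hnq : n ≤ q)
    (IV : Ideal (MvPolynomial (Fin (M + 1)) k)) (hIVprime : IV.IsPrime)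
    (hIVhom : ∃ G : Set (MvPolynomial (Fin (M + 1)) k),
      (∀ g ∈ G, ∃ m, g.IsHomogeneous m) ∧ Ideal.span G = IV)
    (hdim : ringKrullDim (MvPolynomial (Fin (M + 1)) k ⧸ IV) = (n : ℕ) + 1)
    (N : ℕ)
    (γ : (I : Fin n → ℕ) →
      Fin (mNI (fun s : Fin n => QR (Fin.castLE hnq s)) (IAQV A Q Ij IV) d I N) →
        MvPolynomial (Fin (M + 1)) (RAQ A Q Ij))
    (hγmem : ∀ I : Fin n → ℕ, d * ∑ i, I i ≤ N → ∀ ℓ,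
      γ I ℓ ∈ homogeneousSubmodule (Fin (M + 1)) (RAQ A Q Ij) (N - d * ∑ i, I i))
    (hγli : ∀ I : Fin n → ℕ, d * ∑ i, I i ≤ N →
      LinearIndependent (RAQ A Q Ij) fun ℓ =>
        (Submodule.span (RAQ A Q Ij)
          (LNIset (fun s : Fin n => QR (Fin.castLE hnq s)) (IAQV A Q Ij IV) d I N)).mkQ
          (γ I ℓ))
    (hγspan : ∀ I : Fin n → ℕ, d * ∑ i, I i ≤ N →
      Submodule.span (RAQ A Q Ij) (Set.range fun ℓ =>
        (Submodule.span (RAQ A Q Ij)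
          (LNIset (fun s : Fin n => QR (Fin.castLE hnq s)) (IAQV A Q Ij IV) d I N)).mkQ
          (γ I ℓ)) =
      Submodule.map
        (Submodule.span (RAQ A Q Ij)
          (LNIset (fun s : Fin n => QR (Fin.castLE hnq s)) (IAQV A Q Ij IV) d I N)).mkQ
        (homogeneousSubmodule (Fin (M + 1)) (RAQ A Q Ij) (N - d * ∑ i, I i))) :
    (LinearIndependent (RAQ A Q Ij)
      fun p : (I : {I : Fin n → ℕ // d * ∑ i, I i ≤ N}) ×
          Fin (mNI (fun s : Fin n => QR (Fin.castLE hnq s)) (IAQV A Q Ij IV) d I.1 N) =>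
        (Submodule.restrictScalars (RAQ A Q Ij) (IAQV A Q Ij IV)).mkQ
          ((∏ s : Fin n, QR (Fin.castLE hnq s) ^ p.1.1 s) * γ p.1.1 p.2)) ∧
    Submodule.span (RAQ A Q Ij)
      (Set.range fun p : (I : {I : Fin n → ℕ // d * ∑ i, I i ≤ N}) ×
          Fin (mNI (fun s : Fin n => QR (Fin.castLE hnq s)) (IAQV A Q Ij IV) d I.1 N) =>
        (Submodule.restrictScalars (RAQ A Q Ij) (IAQV A Q Ij IV)).mkQ
          ((∏ s : Fin n, QR (Fin.castLE hnq s) ^ p.1.1 s) * γ p.1.1 p.2)) =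
      Submodule.map (Submodule.restrictScalars (RAQ A Q Ij) (IAQV A Q Ij IV)).mkQ
        (homogeneousSubmodule (Fin (M + 1)) (RAQ A Q Ij) N) := by
  have hQRhom : ∀ j, (QR j).IsHomogeneous d := by
    intro j I hI
    by_contra hne
    refine hI ((hQR j I).trans (ratioRAQ_eq_zero fun α => ?_))
    exact (hQhom j α).coeff_eq_zero (by rwa [Finsupp.degree_eq_weight_one])
  refine ⟨linearIndependent_monomial_mul _ _ hd N _ γ hγmem fun I hI => ?_,
    span_monomial_mul _ _ hd (fun s => hQRhom _) N _ γ hγmem fun I hI => ?_⟩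
  · have h := hγli I hI
    rwa [span_LNIset] at h
  · have h := hγspan I hI
    rwa [span_LNIset] at h
end

section
/- Let P_1,…,P_m be homogeneous generators of I(V), assume Q is V-admissible, A ⊂ Λ coherent with respect to Q, and let Q'_j denote the normalized polynomials with coefficients a_{j,I}/a_{j,I_j} ∈ R_{A,Q}, all of degree d. Then for each subset J = {j_0,…,j_n} ⊂ {1,…,q} there exist an element R ∈ R_{A,Q} with R(α) ≠ 0 for all but finitely many α ∈ A, a nonnegative integer s, and homogeneous polynomials b_{i,j_k}, b_{i,ℓ} ∈ R_{A,Q}[x_0,…,x_M] with deg b_{i,j_k} = s − d and deg b_{i,ℓ} = s − deg P_ℓ, such that R·x_i^s = ∑_{k=0}^n b_{i,j_k}·Q'_{j_k} + ∑_{ℓ=1}^m b_{i,ℓ}·P_ℓ for all 0 ≤ i ≤ M. -/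
open Filter MvPolynomial

namespace MovingTargets

/-- The forms of degree `s` with coefficients in an ideal `I` lie in `I` times the module of forms
of degree `s`. -/
theorem mem_smul_homogeneousSubmodule {S σ : Type*} [CommRing S] (I : Ideal S) {s : ℕ}
    {p : MvPolynomial σ S} (hp : p.IsHomogeneous s) (hI : ∀ e, coeff e p ∈ I) :
    p ∈ I • homogeneousSubmodule σ S s := by
  rw [p.as_sum]
  refine Submodule.sum_mem _ fun e he => ?_
  have h : monomial e (coeff e p) = coeff e p • monomial e (1 : S) := by
    rw [smul_monomial, smul_eq_mul, mul_one]
  rw [h]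
  refine Submodule.smul_mem_smul (hI e) ?_
  rw [mem_homogeneousSubmodule]
  refine isHomogeneous_monomial _ ?_
  have := hp (mem_support_iff.mp he)
  rwa [Finsupp.degree_eq_weight_one]

/-- The forms of degree `s` that are combinations of the `F i` with coefficients homogeneous of
degree `s - e i`. -/
def homogeneousCombinations {S σ ι : Type*} [CommRing S] [Fintype ι] (F : ι → MvPolynomial σ S)
    (e : ι → ℕ) (s : ℕ) : Submodule S (MvPolynomial σ S) where
  carrier := {p | ∃ b : ι → MvPolynomial σ S,
    (∀ i, (b i).IsHomogeneous (s - e i)) ∧ p = ∑ i, b i * F i}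
  add_mem' := by
    rintro _ _ ⟨b, hb, rfl⟩ ⟨c, hc, rfl⟩
    exact ⟨fun i => b i + c i, fun i => (hb i).add (hc i), by
      simp only [add_mul, Finset.sum_add_distrib]⟩
  zero_mem' := ⟨fun _ => 0, fun _ => isHomogeneous_zero _ _ _, by simp⟩
  smul_mem' := by
    rintro c _ ⟨b, hb, rfl⟩
    exact ⟨fun i => c • b i, fun i => Submodule.smul_mem (homogeneousSubmodule σ S _) c (hb i), by
      simp only [smul_mul_assoc, Finset.smul_sum]⟩

/-- A form in an ideal generated by forms is a combination of them with homogeneous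
coefficients. -/
theorem mem_homogeneousCombinations {S σ ι : Type*} [CommRing S] [Fintype ι]
    {F : ι → MvPolynomial σ S} {e : ι → ℕ} (hF : ∀ i, (F i).IsHomogeneous (e i)) {s : ℕ}
    (hs : ∀ i, e i ≤ s) {p : MvPolynomial σ S} (hp : p.IsHomogeneous s)
    (hpF : p ∈ Ideal.span (Set.range F)) : p ∈ homogeneousCombinations F e s := by
  classical
  let := gradedAlgebra (σ := σ) (R := S)
  obtain ⟨c, hc⟩ := Ideal.mem_span_range_iff_exists_fun.mp hpF
  refine ⟨fun i => DirectSum.decompose (homogeneousSubmodule σ S) (c i) (s - e i),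
    fun i => (DirectSum.decompose (homogeneousSubmodule σ S) (c i) (s - e i)).2, ?_⟩
  have h : p = DirectSum.decompose (homogeneousSubmodule σ S) p s :=
    (DirectSum.decompose_of_mem_same (homogeneousSubmodule σ S) hp).symm
  rw [h, ← hc, DirectSum.decompose_sum, DFinsupp.finsetSum_apply, AddSubmonoidClass.coe_finsetSum]
  exact Finset.sum_congr rfl fun i _ =>
    DirectSum.coe_decompose_mul_of_right_mem_of_le (homogeneousSubmodule σ S) (hF i) (hs i)

/-- If the variables are nilpotent modulo an ideal, then the ideal contains all forms of
sufficiently large degree. -/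
theorem exists_forall_isHomogeneous_mem {S σ : Type*} [CommRing S] [Finite σ]
    (I : Ideal (MvPolynomial σ S)) (hI : ∀ i, X i ∈ I.radical) :
    ∃ t, ∀ s, t ≤ s → ∀ p : MvPolynomial σ S, p.IsHomogeneous s → p ∈ I := by
  have h : idealOfVars σ S ≤ I.radical := by
    rw [idealOfVars, Ideal.span_le]
    rintro _ ⟨i, rfl⟩
    exact hI i
  obtain ⟨t, ht⟩ := Ideal.exists_pow_le_of_le_radical_of_fg h (idealOfVars_fg σ S)
  refine ⟨t, fun s hs p hp => ht ((mem_pow_idealOfVars_iff t p).mpr fun x hx => ?_)⟩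
  have := hp (mem_support_iff.mp hx)
  rw [Finsupp.degree_eq_weight_one]
  exact hs.trans this.ge

/-- Main theorem of elimination theory at a rational point: if the variables are nilpotent modulo
the specializations along `φ` of the forms `F i`, then there is an inertia form `r` of the `F i`
with `φ r = 1`. -/
theorem exists_inertia_form {S k σ ι : Type*} [CommRing S] [CommRing k] [Finite σ] [Fintype ι]
    (φ : S →+* k) (ψ : k →+* S) (hφψ : ∀ c, φ (ψ c) = c)
    {F : ι → MvPolynomial σ S} {e : ι → ℕ} (hF : ∀ i, (F i).IsHomogeneous (e i))
    (hX : ∀ i, X i ∈ (Ideal.span (Set.range fun j => MvPolynomial.map φ (F j))).radical) :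
    ∃ (r : S) (s : ℕ), φ r = 1 ∧ ∀ i, C r * X i ^ s ∈ homogeneousCombinations F e s := by
  obtain ⟨t, ht⟩ := exists_forall_isHomogeneous_mem _ hX
  set s := t + ∑ i, e i with hs
  have hes : ∀ i, e i ≤ s := fun i =>
    (Finset.single_le_sum (fun _ _ => Nat.zero_le _) (Finset.mem_univ i)).trans
      (Nat.le_add_left _ _)
  set W := homogeneousCombinations F e s
  have key : (homogeneousSubmodule σ S s).map W.mkQ ≤
      RingHom.ker φ • (homogeneousSubmodule σ S s).map W.mkQ := by
    rw [← Submodule.map_smul'', Submodule.map_le_iff_le_comap, Submodule.comap_map_mkQ]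
    intro p hp
    have hp' : (MvPolynomial.map φ p).IsHomogeneous s := IsHomogeneous.map hp φ
    obtain ⟨b, hb, hpb⟩ := mem_homogeneousCombinations (fun i => (hF i).map φ) hes hp'
      (ht s (Nat.le_add_right _ _) _ hp')
    have hmap : ∀ q : MvPolynomial σ k, MvPolynomial.map φ (MvPolynomial.map ψ q) = q := fun q => by
      rw [MvPolynomial.map_map, RingHom.ext (f := φ.comp ψ) (g := RingHom.id k) hφψ,
        MvPolynomial.map_id]
    have hbF : ∑ i, MvPolynomial.map ψ (b i) * F i ∈ homogeneousSubmodule σ S s :=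
      Submodule.sum_mem _ fun i _ => by
        have := ((hb i).map ψ).mul (hF i)
        rwa [Nat.sub_add_cancel (hes i)] at this
    rw [← add_sub_cancel (∑ i, MvPolynomial.map ψ (b i) * F i) p]
    refine Submodule.add_mem_sup ⟨_, fun i => (hb i).map ψ, rfl⟩
      (mem_smul_homogeneousSubmodule _ (Submodule.sub_mem _ hp hbF) fun a => ?_)
    rw [RingHom.mem_ker, ← coeff_map, map_sub, map_sum, hpb]
    simp only [map_mul, hmap, sub_self, coeff_zero]
  obtain ⟨r, hr, hr0⟩ := Submodule.exists_sub_one_mem_and_smul_eq_zero_of_fg_of_le_smul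
    (RingHom.ker φ) _ ((homogeneousSubmodule_fg σ S s).map W.mkQ) key
  refine ⟨r, s, ?_, fun i => ?_⟩
  · rwa [RingHom.mem_ker, map_sub, map_one, sub_eq_zero] at hr
  · have := hr0 (W.mkQ (X i ^ s)) (Submodule.mem_map_of_mem (isHomogeneous_X_pow i s))
    rw [← map_smul, Submodule.mkQ_apply, Submodule.Quotient.mk_eq_zero] at this
    rwa [← smul_eq_C_mul]

/-- An element of the ring generated by the coefficient ratios is, up to a product of powers of
the normalizing coefficients, a block-homogeneous polynomial in the coefficients. -/
theorem exists_homogenization {k Λ : Type} [Field k] {M q : ℕ}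
    (Q : Fin q → Λ → MvPolynomial (Fin (M + 1)) k) (Ij : Fin q → (Fin (M + 1) →₀ ℕ))
    {f : Λ → k} (hf : f ∈ kQRing Q Ij) :
    ∃ (P : MvPolynomial (Fin q × (Fin (M + 1) →₀ ℕ)) k) (e : Fin q → ℕ),
      (∀ j, IsWeightedHomogeneous (fun v : Fin q × (Fin (M + 1) →₀ ℕ) => if v.1 = j then 1 else 0)
        P (e j)) ∧
      ∀ α, (∀ j, coeff (Ij j) (Q j α) ≠ 0) →
        eval (fun p => coeff p.2 (Q p.1 α)) P = f α * ∏ j, coeff (Ij j) (Q j α) ^ e j := by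
  classical
  have hpow : ∀ (e : Fin q → ℕ) (j : Fin q),
      IsWeightedHomogeneous (fun v : Fin q × (Fin (M + 1) →₀ ℕ) => if v.1 = j then 1 else 0)
        (∏ i, X (R := k) (i, Ij i) ^ e i) (e j) := fun e j => by
    have := IsWeightedHomogeneous.prod Finset.univ (fun i => X (R := k) (i, Ij i) ^ e i) _
      fun i _ => (isWeightedHomogeneous_X k
        (fun v : Fin q × (Fin (M + 1) →₀ ℕ) => if v.1 = j then 1 else 0) (i, Ij i)).pow (e i)
    simpa using this
  induction hf using Subring.closure_induction with
  | mem f hf =>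
    rcases hf with ⟨c, rfl⟩ | ⟨j, I, rfl⟩
    · exact ⟨C c, 0, fun j => isWeightedHomogeneous_C _ c, fun α _ => by simp⟩
    · refine ⟨X (j, I), Pi.single j 1, fun i => ?_, fun α hα => ?_⟩
      · convert! isWeightedHomogeneous_X k _ (j, I) using 1
        simp [Pi.single_apply, eq_comm]
      · rw [Finset.prod_eq_single j (fun i _ hi => by simp [hi]) (by simp)]
        simp [ratioFun, div_mul_cancel₀ _ (hα j)]
  | zero => exact ⟨0, 0, fun j => isWeightedHomogeneous_zero _ _ _, fun α _ => by simp⟩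
  | one => exact ⟨1, 0, fun j => isWeightedHomogeneous_one _ _, fun α _ => by simp⟩
  | add f g _ _ ihf ihg =>
    obtain ⟨P, e, hP, hPf⟩ := ihf
    obtain ⟨P', e', hP', hPg⟩ := ihg
    refine ⟨P * ∏ i, X (i, Ij i) ^ e' i + P' * ∏ i, X (i, Ij i) ^ e i, e + e',
      fun j => ((hP j).mul (hpow e' j)).add ?_, fun α hα => ?_⟩
    · exact add_comm (e' j) (e j) ▸ (hP' j).mul (hpow e j)
    · simp only [map_add, map_mul, map_prod, map_pow, eval_X, hPf α hα, hPg α hα, Pi.add_apply,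
        pow_add, Finset.prod_mul_distrib]
      ring
  | neg f _ ih =>
    obtain ⟨P, e, hP, hPf⟩ := ih
    exact ⟨-P, e, fun j => (hP j).neg, fun α hα => by simp [hPf α hα]⟩
  | mul f g _ _ ihf ihg =>
    obtain ⟨P, e, hP, hPf⟩ := ihf
    obtain ⟨P', e', hP', hPg⟩ := ihg
    refine ⟨P * P', e + e', fun j => (hP j).mul (hP' j), fun α hα => ?_⟩
    simp only [map_mul, hPf α hα, hPg α hα, Pi.add_apply, Pi.mul_apply, pow_add,
      Finset.prod_mul_distrib]
    ring

/-- Over a coherent set, an element of the ring generated by the coefficient ratios that does not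
vanish at one point vanishes at only finitely many points. -/
theorem eventually_ne_zero_of_coherent {k Λ : Type} [Field k] {M q : ℕ} {A : Set Λ}
    {Q : Fin q → Λ → MvPolynomial (Fin (M + 1)) k} (hcoh : Coherent A Q)
    {Ij : Fin q → (Fin (M + 1) →₀ ℕ)}
    (hIj : ∀ j, ∀ᶠ α in cofinOn Λ A, coeff (Ij j) (Q j α) ≠ 0)
    {f : Λ → k} (hf : f ∈ kQRing Q Ij) {α₀ : Λ} (hα₀ : α₀ ∈ A)
    (hQα₀ : ∀ j, coeff (Ij j) (Q j α₀) ≠ 0) (hfα₀ : f α₀ ≠ 0) :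
    ∀ᶠ α in cofinOn Λ A, f α ≠ 0 := by
  obtain ⟨P, e, hP, hPf⟩ := exists_homogenization Q Ij hf
  rcases hcoh P fun j => ⟨e j, fun m hm => by
    simpa [Finsupp.weight_apply] using hP j (mem_support_iff.mp hm)⟩ with h | h
  · refine absurd (h α₀ hα₀) ?_
    rw [hPf α₀ hQα₀]
    exact mul_ne_zero hfα₀ (Finset.prod_ne_zero_iff.mpr fun j _ => pow_ne_zero _ (hQα₀ j))
  · have h' : ∀ᶠ α in cofinOn Λ A, α ∈ A ∧
        α ∉ {α ∈ A | eval (fun p => coeff p.2 (Q p.1 α)) P = 0} :=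
      (Filter.eventually_inf_principal.mpr (Filter.Eventually.of_forall fun _ h => h)).and
        (h.eventually_cofinite_notMem.filter_mono inf_le_left)
    filter_upwards [h', Filter.eventually_all.mpr hIj] with α hα hQα hfα
    exact hα.2 ⟨hα.1, by rw [hPf α hQα, hfα, zero_mul]⟩

/-- The canonical map from the ring generated by the coefficient ratios to `R_{A,Q}`. -/
noncomputable def toRAQHom {k Λ : Type} [Field k] {M q : ℕ} (A : Set Λ)
    (Q : Fin q → Λ → MvPolynomial (Fin (M + 1)) k) (Ij : Fin q → (Fin (M + 1) →₀ ℕ)) :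
    kQRing Q Ij →+* RAQ A Q Ij :=
  (algebraMap (SG A Q Ij) (RAQ A Q Ij)).comp
    (((germHom A).comp (kQRing Q Ij).subtype).codRestrict (SG A Q Ij) fun f =>
      Subring.mem_map.mpr ⟨f, f.2, rfl⟩)

/-- The embedding of `k` into the ring generated by the coefficient ratios. -/
noncomputable def constHom {k Λ : Type} [Field k] {M q : ℕ}
    (Q : Fin q → Λ → MvPolynomial (Fin (M + 1)) k) (Ij : Fin q → (Fin (M + 1) →₀ ℕ)) :
    k →+* kQRing Q Ij :=
  (Pi.constRingHom Λ k).codRestrict (kQRing Q Ij) fun c =>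
    Subring.subset_closure (Or.inl ⟨c, rfl⟩)

/-- The normalized moving hypersurfaces, with coefficients in the ring generated by the coefficient
ratios. -/
theorem exists_normalized {k Λ : Type} [Field k] {M q : ℕ}
    (Q : Fin q → Λ → MvPolynomial (Fin (M + 1)) k) {d : ℕ}
    (hQ : ∀ j α, (Q j α).IsHomogeneous d) (Ij : Fin q → (Fin (M + 1) →₀ ℕ)) (j : Fin q) :
    ∃ F : MvPolynomial (Fin (M + 1)) (kQRing Q Ij), F.IsHomogeneous d ∧
      ∀ I, ((coeff I F : kQRing Q Ij) : Λ → k) = ratioFun Q Ij j I := by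
  classical
  have hfin := Finsupp.finite_of_degree_le (σ := Fin (M + 1)) d
  set a : (Fin (M + 1) →₀ ℕ) → kQRing Q Ij := fun I =>
    ⟨ratioFun Q Ij j I, Subring.subset_closure (Or.inr ⟨j, I, rfl⟩)⟩
  have ha : ∀ I, I.degree ≠ d → a I = 0 := fun I hI => by
    refine Subtype.ext (funext fun α => ?_)
    have : coeff I (Q j α) = 0 := (hQ j α).coeff_eq_zero hI
    simp [a, ratioFun, this]
  have hcoeff : ∀ I, coeff I (∑ I ∈ hfin.toFinset, monomial I (a I)) = a I := fun I => by
    rw [coeff_sum]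
    simp only [coeff_monomial, Finset.sum_ite_eq', Set.Finite.mem_toFinset, Set.mem_ofPred_eq]
    split_ifs with h
    · rfl
    · exact (ha I fun h' => h h'.le).symm
  refine ⟨∑ I ∈ hfin.toFinset, monomial I (a I), fun I hI => ?_, fun I => by rw [hcoeff]⟩
  rw [hcoeff] at hI
  by_contra h
  refine hI (ha I ?_)
  rwa [Finsupp.degree_eq_weight_one]

end MovingTargets

set_option maxHeartbeats 1000000 in
open MovingTargets Filter MvPolynomial in
/-- (Inertia forms, equations (2.2)–(2.3).) Let `P_1,…,P_m` be
homogeneous generators of `I(V)`, let `Q` be `V`-admissible, `A` coherent, and let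
`Q'_j` denote the normalized moving hypersurfaces with coefficients
`a_{j,I}/a_{j,I_j} ∈ R_{A,Q}`. Then for each subset `J ⊆ {1,…,q}` with `n+1` elements
there exist `R ∈ R_{A,Q}` with `R(α) ≠ 0` for all but finitely many `α ∈ A`, a
nonnegative integer `s`, and homogeneous polynomials `b_{i,j}`, `b'_{i,ℓ}` with
`deg b_{i,j} = s − d`, `deg b'_{i,ℓ} = s − deg P_ℓ`, such that
`R·x_iˢ = ∑_{j∈J} b_{i,j}·Q'_j + ∑_ℓ b'_{i,ℓ}·P_ℓ` for all `0 ≤ i ≤ M`. -/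
theorem inertia_form_identity
    {k Λ : Type} [Field k] [NumberField k] {M q : ℕ}
    (hq : 0 < q)
    (Q : Fin q → Λ → MvPolynomial (Fin (M + 1)) k)
    (d : ℕ) (hd : 0 < d)
    (hQhom : ∀ j α, (Q j α).IsHomogeneous d)
    (hQne : ∀ j α, Q j α ≠ 0)
    (A : Set Λ) (hA : A.Infinite) (hcoh : Coherent A Q)
    (Ij : Fin q → (Fin (M + 1) →₀ ℕ))
    (hIj : ∀ j, ∀ᶠ α in cofinOn Λ A, MvPolynomial.coeff (Ij j) (Q j α) ≠ 0)
    (QR : Fin q → MvPolynomial (Fin (M + 1)) (RAQ A Q Ij))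
    (hQR : ∀ j I, MvPolynomial.coeff I (QR j) = ratioRAQ A Q Ij j I)
    {n : ℕ} (hnq : n ≤ q)
    (IV : Ideal (MvPolynomial (Fin (M + 1)) k)) (hIVprime : IV.IsPrime)
    (hIVhom : ∃ G : Set (MvPolynomial (Fin (M + 1)) k),
      (∀ g ∈ G, ∃ m, g.IsHomogeneous m) ∧ Ideal.span G = IV)
    (hdim : ringKrullDim (MvPolynomial (Fin (M + 1)) k ⧸ IV) = (n : ℕ) + 1)
    (hadm : Admissible IV Q n)
    {m : ℕ} (P : Fin m → MvPolynomial (Fin (M + 1)) k) (degP : Fin m → ℕ)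
    (hPhom : ∀ ℓ, (P ℓ).IsHomogeneous (degP ℓ))
    (hPgen : Ideal.span (Set.range P) = IV) :
    ∀ J : Finset (Fin q), J.card = n + 1 →
      ∃ (R : RAQ A Q Ij) (Rhat : Λ → k) (s : ℕ)
        (b : Fin (M + 1) → Fin q → MvPolynomial (Fin (M + 1)) (RAQ A Q Ij))
        (b' : Fin (M + 1) → Fin m → MvPolynomial (Fin (M + 1)) (RAQ A Q Ij)),
        IsSpecialRep A Q Ij R Rhat ∧
        (∀ᶠ α in cofinOn Λ A, Rhat α ≠ 0) ∧
        (∀ i, ∀ j ∈ J, (b i j).IsHomogeneous (s - d)) ∧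
        (∀ i ℓ, (b' i ℓ).IsHomogeneous (s - degP ℓ)) ∧
        ∀ i : Fin (M + 1),
          MvPolynomial.C R * MvPolynomial.X i ^ s =
            (∑ j ∈ J, b i j * QR j) +
              ∑ ℓ, b' i ℓ * MvPolynomial.map (kToRAQ A Q Ij) (P ℓ) := by
  classical
  intro J hJ
  choose F hFhom hFcoeff using exists_normalized Q hQhom Ij
  have hev : ∀ᶠ α in cofinOn Λ A, α ∈ A ∧ (∀ j, coeff (Ij j) (Q j α) ≠ 0) ∧ _ :=
    (Filter.eventually_inf_principal.mpr (Filter.Eventually.of_forall fun _ h => h)).and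
      ((Filter.eventually_all.mpr hIj).and
        ((hadm J hJ).eventually_cofinite_notMem.filter_mono inf_le_left))
  have : (cofinOn Λ A).NeBot := Filter.cofinite_inf_principal_neBot_iff.mpr hA
  obtain ⟨α₀, hα₀, hQα₀, hno⟩ := hev.exists
  let φ : kQRing Q Ij →+* k := (Pi.evalRingHom (fun _ : Λ => k) α₀).comp (kQRing Q Ij).subtype
  let G : J ⊕ Fin m → MvPolynomial (Fin (M + 1)) (kQRing Q Ij) :=
    Sum.elim (fun j => F j) fun ℓ => MvPolynomial.map (constHom Q Ij) (P ℓ)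
  let e : J ⊕ Fin m → ℕ := Sum.elim (fun _ => d) degP
  have hG : ∀ i, (G i).IsHomogeneous (e i) := by
    rintro (j | ℓ)
    · exact hFhom j
    · exact (hPhom ℓ).map _
  have hφ : ∀ c, φ (constHom Q Ij c) = c := fun c => rfl
  have hφF : ∀ j, MvPolynomial.map φ (F j) = C (coeff (Ij j) (Q j α₀))⁻¹ * Q j α₀ := fun j => by
    ext I
    rw [coeff_map, coeff_C_mul]
    change ((coeff I (F j) : kQRing Q Ij) : Λ → k) α₀ = _
    rw [hFcoeff, ratioFun, div_eq_inv_mul]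
  have hφP : ∀ ℓ, MvPolynomial.map φ (MvPolynomial.map (constHom Q Ij) (P ℓ)) = P ℓ := fun ℓ => by
    rw [MvPolynomial.map_map, RingHom.ext (f := φ.comp _) (g := RingHom.id k) hφ,
      MvPolynomial.map_id]
  have hX : ∀ i, X i ∈ (Ideal.span (Set.range fun j => MvPolynomial.map φ (G j))).radical := by
    intro i
    rw [← vanishingIdeal_zeroLocus_eq_radical (K := AlgebraicClosure k), mem_vanishingIdeal_iff]
    intro x hx
    rw [zeroLocus_span] at hx
    have hx0 : x = 0 := by
      by_contra hx0
      refine hno ⟨x, hx0, fun p hp => ?_, fun j hj => ?_⟩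
      · have hle : IV ≤ RingHom.ker (aeval (R := k) x) := by
          rw [← hPgen, Ideal.span_le]
          rintro _ ⟨ℓ, rfl⟩
          have := hx _ ⟨Sum.inr ℓ, rfl⟩
          simp only [G, Sum.elim_inr, hφP] at this
          exact RingHom.mem_ker.mpr this
        rw [eval_map, ← aeval_def]
        exact hle hp
      · have := hx _ ⟨Sum.inl ⟨j, hj⟩, rfl⟩
        simp only [G, Sum.elim_inl, hφF, map_mul, aeval_C] at this
        rw [eval_map, ← aeval_def]
        refine (mul_eq_zero.mp this).resolve_left ?_
        exact (map_ne_zero _).mpr (inv_ne_zero (hQα₀ j))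
    rw [aeval_X, hx0, Pi.zero_apply]
  obtain ⟨r, s, hr, hrs⟩ := exists_inertia_form φ (constHom Q Ij) hφ hG hX
  choose b hb hrb using hrs
  have hFQ : ∀ j, MvPolynomial.map (toRAQHom A Q Ij) (F j) = QR j := fun j => by
    ext I
    rw [coeff_map, hQR]
    have : coeff I (F j) =
        ⟨ratioFun Q Ij j I, Subring.subset_closure (Or.inr ⟨j, I, rfl⟩)⟩ :=
      Subtype.ext (hFcoeff j I)
    rw [this]
    rfl
  have hPk : ∀ ℓ, MvPolynomial.map (toRAQHom A Q Ij) (MvPolynomial.map (constHom Q Ij) (P ℓ)) =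
      MvPolynomial.map (kToRAQ A Q Ij) (P ℓ) := fun ℓ => by
    rw [MvPolynomial.map_map]
    rfl
  have hr0 : ∀ᶠ α in cofinOn Λ A, (r : Λ → k) α ≠ 0 := by
    refine eventually_ne_zero_of_coherent hcoh hIj r.2 hα₀ hQα₀ ?_
    change φ r ≠ 0
    rw [hr]
    exact one_ne_zero
  refine ⟨toRAQHom A Q Ij r, r, s,
    fun i j => if hj : j ∈ J then MvPolynomial.map (toRAQHom A Q Ij) (b i (Sum.inl ⟨j, hj⟩)) else 0,
    fun i ℓ => MvPolynomial.map (toRAQHom A Q Ij) (b i (Sum.inr ℓ)),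
    ⟨r, 1, r.2, one_mem _, Filter.Eventually.of_forall fun _ => one_ne_zero, ?_, ?_⟩, hr0,
    fun i j hj => ?_, fun i ℓ => (hb i (Sum.inr ℓ)).map _, fun i => ?_⟩
  · have h1 : toRAQ A Q Ij 1 (one_mem _) = 1 := map_one (toRAQHom A Q Ij)
    rw [h1, mul_one]
    rfl
  · funext α
    rw [Pi.one_apply, div_one]
  · simp only [hj, dif_pos]
    exact (hb i (Sum.inl ⟨j, hj⟩)).map _
  · have h := congrArg (MvPolynomial.map (toRAQHom A Q Ij)) (hrb i)
    rw [map_mul, map_C, map_pow, map_X, map_sum, Fintype.sum_sum_type] at h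
    rw [h, ← Finset.sum_coe_sort J]
    simp only [G, Sum.elim_inl, Sum.elim_inr, map_mul, hFQ, hPk, Finset.coe_mem, dif_pos,
      Subtype.coe_eta]
end

section
/- Let A ⊂ Λ be coherent with respect to Q. For all sufficiently large N, dim_{R_{A,Q}} R_{A,Q}[x_0,…,x_M]_N/I_{A,Q}(V)_N = H_V(N) = dim_k k[x_0,…,x_M]_N/I(V)_N = deg V·N^n/n! + O(N^{n−1}). -/
open Filter MvPolynomial

namespace MovingTargets

/-- Extending scalars along a homomorphism from a field to a nontrivial commutative ring does not
change the rank of the degree `N` part of the quotient by an ideal. -/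
theorem hilbert_map {k R σ : Type} [Field k] [CommRing R] [Nontrivial R] (φ : k →+* R)
    (I : Ideal (MvPolynomial σ k)) (N : ℕ) :
    hilbert (Ideal.map (MvPolynomial.map φ) I) N = hilbert I N := by
  classical
  unfold hilbert
  set T := Submodule.restrictScalars k I
  set T' := Submodule.restrictScalars R (Ideal.map (MvPolynomial.map φ) I)
  set W := Submodule.map T.mkQ (homogeneousSubmodule σ k N)
  set W' := Submodule.map T'.mkQ (homogeneousSubmodule σ R N)
  let b := Module.Basis.ofVectorSpace k W
  obtain ⟨p, hp⟩ := W.subtype.exists_leftInverse_of_injective W.ker_subtype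
  choose h hhom hb using fun i => Submodule.mem_map.1 (b i).2
  let f : MvPolynomial σ k →ₗ[k] _ →₀ k := b.repr.toLinearMap ∘ₗ p ∘ₗ T.mkQ
  have hfh : ∀ i, f (h i) = Finsupp.single i 1 := fun i => by
    have : p (b i : _ ⧸ T) = b i := LinearMap.congr_fun hp (b i)
    simp [f, hb, this]
  have hfT : ∀ t ∈ I, f t = 0 := fun t ht => by
    have : T.mkQ t = 0 := (Submodule.Quotient.mk_eq_zero T).2 ht
    simp only [f, LinearMap.comp_apply, this, map_zero]
  let g : MvPolynomial σ R →ₗ[R] _ →₀ R := (basisMonomials σ R).constr R fun m =>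
    (f (monomial m 1)).mapRange φ φ.map_zero
  have hg1 : ∀ m, g (monomial m 1) = (f (monomial m 1)).mapRange φ φ.map_zero := fun m => by
    have := (basisMonomials σ R).constr_basis R
      (fun m => (f (monomial m 1)).mapRange φ φ.map_zero) m
    rwa [coe_basisMonomials] at this
  have hg : ∀ P, g (MvPolynomial.map φ P) = (f P).mapRange φ φ.map_zero := fun P => by
    induction P using MvPolynomial.induction_on' with
    | monomial m a =>
      have h1 : (monomial m a : MvPolynomial σ k) = a • monomial m 1 := by simp [smul_monomial]
      have h2 : (monomial m (φ a) : MvPolynomial σ R) = φ a • monomial m 1 := by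
        simp [smul_monomial]
      rw [map_monomial, h2, h1, map_smul, map_smul, hg1]
      ext i
      simp
    | add P P' hP hP' =>
      rw [map_add, map_add, map_add, hP, hP']
      ext i
      simp
  have hgT : T' ≤ LinearMap.ker g := fun P hP => by
    replace hP : P ∈ Ideal.map (MvPolynomial.map φ) I := hP
    suffices ∀ Y, g (Y * P) = 0 by simpa using this 1
    induction hP using Submodule.span_induction with
    | mem x hx =>
      obtain ⟨t, ht, rfl⟩ := hx
      intro Y
      induction Y using MvPolynomial.induction_on' with
      | monomial m a =>
        have h1 : (monomial m a : MvPolynomial σ R) * MvPolynomial.map φ t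
            = a • MvPolynomial.map φ (monomial m 1 * t) := by
          rw [map_mul, map_monomial, map_one, ← smul_mul_assoc, smul_monomial, smul_eq_mul,
            mul_one]
        rw [h1, map_smul, hg, hfT _ (I.mul_mem_left _ ht), Finsupp.mapRange_zero,
          smul_zero]
      | add Y Y' hY hY' => rw [add_mul, map_add, hY, hY', add_zero]
    | zero => simp
    | add x y _ _ hx hy => intro Y; rw [mul_add, map_add, hx, hy, add_zero]
    | smul a x _ hx => intro Y; rw [smul_eq_mul, ← mul_assoc, hx]
  let g' := T'.liftQ g hgT
  let v : _ → W' := fun i => ⟨T'.mkQ (MvPolynomial.map φ (h i)),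
    Submodule.mem_map_of_mem ((mem_homogeneousSubmodule N _).2
      (((mem_homogeneousSubmodule N _).1 (hhom i)).map φ))⟩
  have hv : LinearIndependent R v := by
    refine LinearIndependent.of_comp (g' ∘ₗ W'.subtype) ?_
    have : (g' ∘ₗ W'.subtype) ∘ v = fun i => Finsupp.single i (1 : R) := by
      ext1 i
      simp [g', v, hg, hfh]
    rw [this]
    exact Finsupp.linearIndependent_single_one R _
  have hspan : ⊤ ≤ Submodule.span R (Set.range v) := by
    let U := Submodule.span R (Set.range fun i => T'.mkQ (MvPolynomial.map φ (h i)))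
    have hU : ∀ s ∈ homogeneousSubmodule σ k N, T'.mkQ (MvPolynomial.map φ s) ∈ U := by
      intro s hs
      let w : W := ⟨T.mkQ s, Submodule.mem_map_of_mem hs⟩
      let s' := (b.repr w).sum fun i c => c • h i
      have hs' : T.mkQ s' = T.mkQ s := by
        have := congrArg W.subtype (b.linearCombination_repr w)
        simpa [s', Finsupp.linearCombination_apply, Finsupp.sum, hb, w] using this
      have hmem : s - s' ∈ I := (Submodule.Quotient.eq T).1 hs'.symm
      have hmap : T'.mkQ (MvPolynomial.map φ s) = T'.mkQ (MvPolynomial.map φ s') := by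
        refine (Submodule.Quotient.eq T').2 ?_
        rw [← map_sub]
        exact Ideal.mem_map_of_mem _ hmem
      rw [hmap]
      simp only [s', Finsupp.sum, map_sum, smul_eq_C_mul, map_mul, map_C]
      refine Submodule.sum_mem _ fun i _ => ?_
      rw [← smul_eq_C_mul, map_smul]
      exact U.smul_mem _ (Submodule.subset_span ⟨i, rfl⟩)
    have hW : W' ≤ U := by
      rintro _ ⟨P, hP, rfl⟩
      rw [P.as_sum, map_sum]
      refine Submodule.sum_mem _ fun m hm => ?_
      have hmon : (monomial m (coeff m P) : MvPolynomial σ R)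
          = coeff m P • MvPolynomial.map φ (monomial m 1) := by
        rw [map_monomial, map_one, smul_monomial, smul_eq_mul, mul_one]
      rw [hmon, map_smul]
      refine U.smul_mem _ (hU _ ((mem_homogeneousSubmodule N _).2 (isHomogeneous_monomial 1 ?_)))
      rw [← (mem_homogeneousSubmodule N P).1 hP (mem_support_iff.1 hm), Finsupp.degree_eq_weight_one]
      rfl
    intro w _
    rw [← Submodule.apply_mem_span_image_iff_mem_span W'.injective_subtype, ← Set.range_comp]
    exact hW w.2
  rw [Module.finrank_eq_nat_card_basis b,
    Module.finrank_eq_nat_card_basis (Module.Basis.mk hv hspan)]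

/-- The ring `R_{A,Q}` is nontrivial when `A` is infinite. -/
theorem nontrivial_RAQ {k Λ : Type} [Field k] {M q : ℕ} {A : Set Λ} (hA : A.Infinite)
    (Q : Fin q → Λ → MvPolynomial (Fin (M + 1)) k) (Ij : Fin q → (Fin (M + 1) →₀ ℕ)) :
    Nontrivial (RAQ A Q Ij) := by
  have : (cofinOn Λ A).NeBot := hA.cofinite_inf_principal_neBot
  have : Nontrivial (SG A Q Ij) := inferInstance
  exact inferInstanceAs (Nontrivial (FractionRing (SG A Q Ij)))

end MovingTargets

set_option maxHeartbeats 1000000 in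
open MovingTargets Filter MvPolynomial in
/-- (Formula (2.11).) Let `A` be coherent with respect to `Q`. For all
sufficiently large `N`:
`dim_{R_{A,Q}} R_{A,Q}[x_0,…,x_M]_N / I_{A,Q}(V)_N = H_V(N)
  = dim_k k[x_0,…,x_M]_N / I(V)_N = deg V·Nⁿ/n! + O(N^{n−1})`
(the middle equality holds by definition of the Hilbert function `hilbert IV`). -/
theorem dim_quotient_IAQV_eq_hilbert
    {k Λ : Type} [Field k] [NumberField k] {M q : ℕ}
    (hq : 0 < q)
    (Q : Fin q → Λ → MvPolynomial (Fin (M + 1)) k)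
    (d : ℕ) (hd : 0 < d)
    (hQhom : ∀ j α, (Q j α).IsHomogeneous d)
    (hQne : ∀ j α, Q j α ≠ 0)
    (A : Set Λ) (hA : A.Infinite) (hcoh : Coherent A Q)
    (Ij : Fin q → (Fin (M + 1) →₀ ℕ))
    (hIj : ∀ j, ∀ᶠ α in cofinOn Λ A, MvPolynomial.coeff (Ij j) (Q j α) ≠ 0)
    (QR : Fin q → MvPolynomial (Fin (M + 1)) (RAQ A Q Ij))
    (hQR : ∀ j I, MvPolynomial.coeff I (QR j) = ratioRAQ A Q Ij j I)
    {n : ℕ} (hnq : n ≤ q)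
    (IV : Ideal (MvPolynomial (Fin (M + 1)) k)) (hIVprime : IV.IsPrime)
    (hIVhom : ∃ G : Set (MvPolynomial (Fin (M + 1)) k),
      (∀ g ∈ G, ∃ m, g.IsHomogeneous m) ∧ Ideal.span G = IV)
    (hdim : ringKrullDim (MvPolynomial (Fin (M + 1)) k ⧸ IV) = (n : ℕ) + 1)
    (degV : ℕ)
    (hdeg : ∃ C : ℝ, ∀ᶠ N : ℕ in Filter.atTop,
      |(hilbert IV N : ℝ) - degV * (N : ℝ) ^ n / n.factorial| ≤ C * (N : ℝ) ^ (n - 1)) :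
    ∃ (C : ℝ) (N₁ : ℕ), ∀ N : ℕ, N₁ ≤ N →
      hilbert (IAQV A Q Ij IV) N = hilbert IV N ∧
      |(hilbert IV N : ℝ) - degV * (N : ℝ) ^ n / n.factorial| ≤ C * (N : ℝ) ^ (n - 1) := by
  obtain ⟨C, hC⟩ := hdeg
  obtain ⟨N₁, hN₁⟩ := Filter.eventually_atTop.1 hC
  have := nontrivial_RAQ hA Q Ij
  exact ⟨C, N₁, fun N hN => ⟨hilbert_map (kToRAQ A Q Ij) IV N, hN₁ N hN⟩⟩
end
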